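/- The homotopy-associativity relation Ass = ∂m₃ of the Yang–Mills kinematic C∞ algebra holds in all remaining degree components: writing Ass(u,v,w) := m₂(m₂(u,v),w) − m₂(u,m₂(v,w)), one has for every smooth gauge parameter λ and gauge fields a₂ = (A₂,φ₂), a₃ = (A₃,φ₃) in K₁: (i) Ass(λ,a₂,a₃) = m₃(m₁λ, a₂, a₃); (ii) Ass(a₂, λ, a₃) = −m₃(a₂, m₁λ, a₃); (iii) Ass(a₂, a₃, λ) = m₃(a₂, a₃, m₁λ); moreover Ass(u,v,w) = 0 for every homogeneous triple (u,v,w) with |u|+|v|+|w| ≤ 3 that neither consists of three degree-1 elements nor of one degree-0 and two degree-1 elements. -/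

import Mathlib

noncomputable section

/-- Points of ℝ^D. -/
abbrev Pt (D : ℕ) := Fin D → ℝ
/-- Scalar fields on ℝ^D. -/
abbrev Fn (D : ℕ) := Pt D → ℝ
/-- Vector fields on ℝ^D (components carry a lower Lorentz index). -/
abbrev Vec (D : ℕ) := Pt D → Fin D → ℝ

/-- Diagonal entries of the Minkowski metric η = diag(−1,1,…,1) (η is its own inverse). -/
def eta (D : ℕ) (μ : Fin D) : ℝ := if (μ : ℕ) = 0 then -1 else 1

/-- Partial derivative ∂_μ. -/
def pd {D : ℕ} (μ : Fin D) (f : Fn D) : Fn D := fun x => fderiv ℝ f x (Pi.single μ 1)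

/-- Minkowski pairing X·Y = η^{μν} X_μ Y_ν. -/
def dot {D : ℕ} (X Y : Vec D) : Fn D := fun x => ∑ μ, eta D μ * X x μ * Y x μ

/-- Divergence ∂·X = ∂^μ X_μ. -/
def divg {D : ℕ} (X : Vec D) : Fn D := fun x => ∑ μ, eta D μ * pd μ (fun y => X y μ) x

/-- Gradient (∂f)_μ = ∂_μ f. -/
def grad {D : ℕ} (f : Fn D) : Vec D := fun x μ => pd μ f x

/-- Wave operator □ = ∂^μ∂_μ on scalars. -/
def box {D : ℕ} (f : Fn D) : Fn D := fun x => ∑ μ, eta D μ * pd μ (pd μ f) x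

/-- Wave operator acting componentwise on vector fields. -/
def boxV {D : ℕ} (X : Vec D) : Vec D := fun x μ => box (fun y => X y μ) x

/-- Generalized Lie derivative product: (X*Y)_μ = X^ν ∂_ν Y_μ + (∂_μ X_ν − ∂_ν X_μ) Y^ν. -/
def starP {D : ℕ} (X Y : Vec D) : Vec D := fun x μ =>
  ∑ ν, eta D ν * (X x ν * pd ν (fun y => Y y μ) x
    + (pd μ (fun y => X y ν) x - pd ν (fun y => X y μ) x) * Y x ν)

/-- Bullet product X•Y = (∂·X)Y − (∂·Y)X + X*Y − Y*X. -/
def bullet {D : ℕ} (X Y : Vec D) : Vec D :=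
  fun x μ => divg X x * Y x μ - divg Y x * X x μ + starP X Y x μ - starP Y X x μ

/-- Pointwise product of scalar fields. -/
def fmul {D : ℕ} (f g : Fn D) : Fn D := fun x => f x * g x

/-- Pointwise scaling of a vector field by a scalar field. -/
def fsmul {D : ℕ} (f : Fn D) (X : Vec D) : Vec D := fun x μ => f x * X x μ

/-- Smoothness of scalar fields. -/
def SmF {D : ℕ} (f : Fn D) : Prop := ContDiff ℝ (⊤ : ℕ∞) f

/-- Smoothness of vector fields. -/
def SmV {D : ℕ} (X : Vec D) : Prop := ∀ μ, ContDiff ℝ (⊤ : ℕ∞) fun x => X x μ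

/-- Differential m₁ : K₀ → K₁, λ ↦ (∂λ, □λ). -/
def m1₀ {D : ℕ} (l : Fn D) : Vec D × Fn D := (grad l, box l)

/-- Differential m₁ : K₁ → K₂, (A,φ) ↦ (□A − ∂φ, ∂·A − φ). -/
def m1₁ {D : ℕ} (a : Vec D × Fn D) : Vec D × Fn D :=
  (fun x μ => boxV a.1 x μ - grad a.2 x μ, fun x => divg a.1 x - a.2 x)

/-- Differential m₁ : K₂ → K₃, (E,e) ↦ □e − ∂·E. -/
def m1₂ {D : ℕ} (e : Vec D × Fn D) : Fn D := fun x => box e.2 x - divg e.1 x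

/-- m₂ on K₀ ⊗ K₀. -/
def m2₀₀ {D : ℕ} (l1 l2 : Fn D) : Fn D := fmul l1 l2

/-- m₂ on K₀ ⊗ K₁: m₂(λ,(A,φ)) = (λA, ∂·(λA)). -/
def m2₀₁ {D : ℕ} (l : Fn D) (a : Vec D × Fn D) : Vec D × Fn D :=
  (fsmul l a.1, divg (fsmul l a.1))

/-- m₂ on K₁ ⊗ K₀: m₂((A,φ),λ) = (λA, ∂·(λA)). -/
def m2₁₀ {D : ℕ} (a : Vec D × Fn D) (l : Fn D) : Vec D × Fn D :=
  (fsmul l a.1, divg (fsmul l a.1))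

/-- m₂ on K₀ ⊗ K₂: m₂(λ,(E,e)) = (λ(E − ∂e), 0). -/
def m2₀₂ {D : ℕ} (l : Fn D) (e : Vec D × Fn D) : Vec D × Fn D :=
  (fun x μ => l x * (e.1 x μ - grad e.2 x μ), 0)

/-- m₂ on K₂ ⊗ K₀: m₂((E,e),λ) = (λ(E − ∂e), 0). -/
def m2₂₀ {D : ℕ} (e : Vec D × Fn D) (l : Fn D) : Vec D × Fn D :=
  (fun x μ => l x * (e.1 x μ - grad e.2 x μ), 0)

/-- m₂ on K₁ ⊗ K₁: m₂((A₁,φ₁),(A₂,φ₂)) = (A₁•A₂, 0). -/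
def m2₁₁ {D : ℕ} (a1 a2 : Vec D × Fn D) : Vec D × Fn D := (bullet a1.1 a2.1, 0)

/-- m₂ on K₁ ⊗ K₂: m₂((A,φ),(E,e)) = A·(∂e − E). -/
def m2₁₂ {D : ℕ} (a e : Vec D × Fn D) : Fn D :=
  dot a.1 (fun x μ => grad e.2 x μ - e.1 x μ)

/-- m₂ on K₂ ⊗ K₁: m₂((E,e),(A,φ)) = A·(∂e − E). -/
def m2₂₁ {D : ℕ} (e a : Vec D × Fn D) : Fn D :=
  dot a.1 (fun x μ => grad e.2 x μ - e.1 x μ)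

/-- m₂ on K₀ ⊗ K₃: m₂(λ,N) = λN. -/
def m2₀₃ {D : ℕ} (l N : Fn D) : Fn D := fmul l N

/-- m₂ on K₃ ⊗ K₀: m₂(N,λ) = λN. -/
def m2₃₀ {D : ℕ} (N l : Fn D) : Fn D := fmul l N

/-- The three-product m₃ on K₁ ⊗ K₁ ⊗ K₁:
m₃((A₁,φ₁),(A₂,φ₂),(A₃,φ₃)) = ((A₁·A₂)A₃ + (A₂·A₃)A₁ − 2(A₁·A₃)A₂, 0) ∈ K₂. -/
def m3 {D : ℕ} (a1 a2 a3 : Vec D × Fn D) : Vec D × Fn D :=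
  (fun x μ => dot a1.1 a2.1 x * a3.1 x μ + dot a2.1 a3.1 x * a1.1 x μ
      - 2 * dot a1.1 a3.1 x * a2.1 x μ, 0)

theorem pd_mul {D : ℕ} (μ : Fin D) {f g : Fn D} (hf : SmF f) (hg : SmF g) (x : Pt D) :
    pd μ (fun y => f y * g y) x = f x * pd μ g x + pd μ f x * g x := by
  have hf' : DifferentiableAt ℝ f x := (hf.differentiable (by simp)) x
  have hg' : DifferentiableAt ℝ g x := (hg.differentiable (by simp)) x
  simp only [pd]
  rw [fderiv_fun_mul hf' hg']
  simp [mul_comm]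

theorem grad_zero {D : ℕ} (x : Pt D) (μ : Fin D) : grad (0 : Fn D) x μ = 0 := by
  simp [grad, pd]

theorem fsmul_fmul {D : ℕ} (f g : Fn D) (X : Vec D) :
    fsmul (fmul f g) X = fsmul f (fsmul g X) := by
  funext x μ
  simp only [fsmul, fmul]
  ring

theorem fsmul_comm {D : ℕ} (f g : Fn D) (X : Vec D) :
    fsmul f (fsmul g X) = fsmul g (fsmul f X) := by
  funext x μ
  simp only [fsmul]
  ring

theorem dot_comm {D : ℕ} (X Y : Vec D) (x : Pt D) : dot X Y x = dot Y X x :=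
  Finset.sum_congr rfl fun _ _ => by ring

theorem bullet_swap {D : ℕ} (X Y : Vec D) (x : Pt D) (μ : Fin D) :
    bullet X Y x μ = -bullet Y X x μ := by
  simp only [bullet]
  ring

/-- The defect of function-linearity of the bullet product in its first argument. -/
theorem bullet_fsmul_left {D : ℕ} {l : Fn D} {X : Vec D} (Y : Vec D) (hl : SmF l) (hX : SmV X)
    (x : Pt D) (μ : Fin D) :
    bullet (fsmul l X) Y x μ = l x * bullet X Y x μ + dot (grad l) X x * Y x μ
      + dot X Y x * grad l x μ - 2 * dot (grad l) Y x * X x μ := by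
  have h (ν κ : Fin D) : pd ν (fun y => l y * X y κ) x
      = l x * pd ν (fun y => X y κ) x + pd ν l x * X x κ := pd_mul ν hl (hX κ) x
  simp only [bullet, divg, starP, dot, fsmul, grad, h]
  simp only [Finset.mul_sum, Finset.sum_mul, mul_add, mul_sub, ← Finset.sum_add_distrib,
    ← Finset.sum_sub_distrib]
  exact Finset.sum_congr rfl fun _ _ => by ring

/-- The defect of function-linearity of the bullet product in its second argument. -/
theorem bullet_fsmul_right {D : ℕ} {l : Fn D} (X : Vec D) {Y : Vec D} (hl : SmF l) (hY : SmV Y)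
    (x : Pt D) (μ : Fin D) :
    bullet X (fsmul l Y) x μ = l x * bullet X Y x μ - dot (grad l) Y x * X x μ
      - dot X Y x * grad l x μ + 2 * dot (grad l) X x * Y x μ := by
  rw [bullet_swap, bullet_fsmul_left X hl hY, bullet_swap Y X, dot_comm Y X]
  ring

/-- the homotopy-associativity relation Ass = ∂m₃ of the Yang–Mills
kinematic C∞ algebra in all remaining degree components: with
Ass(u,v,w) = m₂(m₂(u,v),w) − m₂(u,m₂(v,w)), one has
(i) Ass(λ,a₂,a₃) = m₃(m₁λ,a₂,a₃), (ii) Ass(a₂,λ,a₃) = −m₃(a₂,m₁λ,a₃),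
(iii) Ass(a₂,a₃,λ) = m₃(a₂,a₃,m₁λ); and Ass(u,v,w) = 0 for every homogeneous triple
with |u|+|v|+|w| ≤ 3 that is neither of three degree-1 elements nor of one degree-0
and two degree-1 elements. -/
theorem homotopy_associativity_remaining_components {D : ℕ} (hD : 1 ≤ D)
    (l l1 l2 l3 : Fn D) (a a2 a3 e : Vec D × Fn D) (N : Fn D)
    (hl : SmF l) (hl1 : SmF l1) (hl2 : SmF l2) (hl3 : SmF l3)
    (haV : SmV a.1) (haF : SmF a.2) (ha2V : SmV a2.1) (ha2F : SmF a2.2)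
    (ha3V : SmV a3.1) (ha3F : SmF a3.2) (heV : SmV e.1) (heF : SmF e.2) (hN : SmF N) :
    -- (i)  Ass(λ,a₂,a₃) = m₃(m₁λ,a₂,a₃)
    m2₁₁ (m2₀₁ l a2) a3 - m2₀₂ l (m2₁₁ a2 a3) = m3 (m1₀ l) a2 a3 ∧
    -- (ii)  Ass(a₂,λ,a₃) = −m₃(a₂,m₁λ,a₃)
    m2₁₁ (m2₁₀ a2 l) a3 - m2₁₁ a2 (m2₀₁ l a3) = -(m3 a2 (m1₀ l) a3) ∧
    -- (iii)  Ass(a₂,a₃,λ) = m₃(a₂,a₃,m₁λ)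
    m2₂₀ (m2₁₁ a2 a3) l - m2₁₁ a2 (m2₁₀ a3 l) = m3 a2 a3 (m1₀ l) ∧
    -- vanishing of Ass on all other triples of total degree ≤ 3:
    -- (0,0,0)
    m2₀₀ (m2₀₀ l1 l2) l3 - m2₀₀ l1 (m2₀₀ l2 l3) = 0 ∧
    -- (0,0,1), (0,1,0), (1,0,0)
    m2₀₁ (m2₀₀ l1 l2) a - m2₀₁ l1 (m2₀₁ l2 a) = 0 ∧
    m2₁₀ (m2₀₁ l1 a) l2 - m2₀₁ l1 (m2₁₀ a l2) = 0 ∧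
    m2₁₀ (m2₁₀ a l1) l2 - m2₁₀ a (m2₀₀ l1 l2) = 0 ∧
    -- (0,0,2), (0,2,0), (2,0,0)
    m2₀₂ (m2₀₀ l1 l2) e - m2₀₂ l1 (m2₀₂ l2 e) = 0 ∧
    m2₂₀ (m2₀₂ l1 e) l2 - m2₀₂ l1 (m2₂₀ e l2) = 0 ∧
    m2₂₀ (m2₂₀ e l1) l2 - m2₂₀ e (m2₀₀ l1 l2) = 0 ∧
    -- (0,0,3), (0,3,0), (3,0,0)
    m2₀₃ (m2₀₀ l1 l2) N - m2₀₃ l1 (m2₀₃ l2 N) = 0 ∧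
    m2₃₀ (m2₀₃ l1 N) l2 - m2₀₃ l1 (m2₃₀ N l2) = 0 ∧
    m2₃₀ (m2₃₀ N l1) l2 - m2₃₀ N (m2₀₀ l1 l2) = 0 ∧
    -- (0,1,2), (0,2,1), (1,0,2), (1,2,0), (2,0,1), (2,1,0)
    m2₁₂ (m2₀₁ l1 a) e - m2₀₃ l1 (m2₁₂ a e) = 0 ∧
    m2₂₁ (m2₀₂ l1 e) a - m2₀₃ l1 (m2₂₁ e a) = 0 ∧
    m2₁₂ (m2₁₀ a l1) e - m2₁₂ a (m2₀₂ l1 e) = 0 ∧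
    m2₃₀ (m2₁₂ a e) l1 - m2₁₂ a (m2₂₀ e l1) = 0 ∧
    m2₂₁ (m2₂₀ e l1) a - m2₂₁ e (m2₀₁ l1 a) = 0 ∧
    m2₃₀ (m2₂₁ e a) l1 - m2₂₁ e (m2₁₀ a l1) = 0 := by
  refine ⟨?_, ?_, ?_, ?_, ?_, ?_, ?_, ?_, ?_, ?_, ?_, ?_, ?_, ?_, ?_, ?_, ?_, ?_, ?_⟩
  · refine Prod.ext ?_ (by simp [m2₁₁, m2₀₂, m3])
    funext x μ
    simp only [m2₁₁, m2₀₁, m2₀₂, m3, m1₀, Prod.fst_sub, Pi.sub_apply, grad_zero,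
      bullet_fsmul_left _ hl ha2V]
    ring
  · refine Prod.ext ?_ (by simp [m2₁₁, m3])
    funext x μ
    simp only [m2₁₁, m2₀₁, m2₁₀, m3, m1₀, Prod.fst_sub, Prod.fst_neg, Pi.sub_apply, Pi.neg_apply,
      bullet_fsmul_left _ hl ha2V, bullet_fsmul_right _ hl ha3V, dot_comm a2.1 (grad l)]
    ring
  · refine Prod.ext ?_ (by simp [m2₁₁, m2₂₀, m3])
    funext x μ
    simp only [m2₁₁, m2₁₀, m2₂₀, m3, m1₀, Prod.fst_sub, Pi.sub_apply, grad_zero,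
      bullet_fsmul_right _ hl ha3V, dot_comm _ (grad l)]
    ring
  · exact sub_eq_zero.2 (funext fun x => by simp only [m2₀₀, fmul]; ring)
  · simp only [m2₀₁, m2₀₀, fsmul_fmul, sub_self]
  · simp only [m2₁₀, m2₀₁, fsmul_comm l1 l2, sub_self]
  · simp only [m2₁₀, m2₀₀, fsmul_fmul, fsmul_comm l1 l2, sub_self]
  iterate 3
    refine sub_eq_zero.2 (Prod.ext (funext fun x => funext fun μ => ?_) rfl)
    simp only [m2₀₂, m2₂₀, m2₀₀, fmul, grad_zero]
    ring
  iterate 3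
    refine sub_eq_zero.2 (funext fun x => ?_)
    simp only [m2₀₃, m2₃₀, m2₀₀, fmul]
    ring
  all_goals
    refine sub_eq_zero.2 (funext fun x => ?_)
    simp only [m2₁₂, m2₂₁, m2₀₁, m2₁₀, m2₀₂, m2₂₀, m2₀₃, m2₃₀, fmul, fsmul, dot, grad_zero,
      Finset.mul_sum]
    exact Finset.sum_congr rfl fun _ _ => by ring
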